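/- Let E be a centrally orthocomplete pseudo-effect algebra and K ⊆ E a type-determining set. Then c_{K' ∩ γ(K')} = (c_K)', i.e., the restricted type-cover of the type-determining set K' equals the Boolean complement of the type-cover of K. -/

import Mathlib

namespace PEApaper

/-- The bare data of a partial-addition structure: a partial binary operation
(encoded via `Option`) together with constants `0` and `1`. -/
structure PartialStruct (E : Type) where
  padd : E → E → Option E
  zero : E
  one : E

namespace PartialStruct

variable {E : Type}

/-- `a ≤ b` iff `a + c = b` for some `c`. -/
def le (P : PartialStruct E) (a b : E) : Prop := ∃ c, P.padd a c = some b

/-- `m` is the greatest lower bound (meet `a ∧ b`) of `a` and `b`. -/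
def IsMeet (P : PartialStruct E) (a b m : E) : Prop :=
  P.le m a ∧ P.le m b ∧ ∀ x, P.le x a → P.le x b → P.le x m

/-- `j` is the least upper bound (join `a ∨ b`) of `a` and `b`. -/
def IsJoin (P : PartialStruct E) (a b j : E) : Prop :=
  P.le a j ∧ P.le b j ∧ ∀ x, P.le a x → P.le b x → P.le j x

/-- `s` is the supremum of the set `S`. -/
def IsSup (P : PartialStruct E) (S : Set E) (s : E) : Prop :=
  (∀ x ∈ S, P.le x s) ∧ ∀ u, (∀ x ∈ S, P.le x u) → P.le s u

/-- Left-associated partial sum of a list, continuing from `acc`. -/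
def IsSumFrom (P : PartialStruct E) : E → List E → E → Prop
  | acc, [], s => s = acc
  | acc, a :: l, s => ∃ t, P.padd acc a = some t ∧ IsSumFrom P t l s

/-- `s` is the (left-associated) orthosum `e₁ + e₂ + ⋯ + eₙ` of the list. -/
def IsSumList (P : PartialStruct E) (l : List E) (s : E) : Prop :=
  match l with
  | [] => s = P.zero
  | a :: t => IsSumFrom P a t s

/-- `c` is a central element: there is a PEA-isomorphism
`f : E → E[0,c] × E[0,c∼]` with `f c = (c,0)` such that `f x = (x₁,x₂)`
implies `x = x₁ + x₂`.  The isomorphism onto the product of the two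
interval pseudo-effect algebras is spelled out explicitly. -/
def IsCentral (P : PartialStruct E) (c : E) : Prop :=
  ∃ cs, P.padd c cs = some P.one ∧
    ∃ f : E → E × E,
      (∀ x, P.le (f x).1 c ∧ P.le (f x).2 cs) ∧
      Function.Injective f ∧
      (∀ y : E × E, P.le y.1 c → P.le y.2 cs → ∃ x, f x = y) ∧
      f c = (c, P.zero) ∧
      f P.one = (c, cs) ∧
      (∀ x, P.padd (f x).1 (f x).2 = some x) ∧
      (∀ a b ab, P.padd a b = some ab →
        P.padd (f a).1 (f b).1 = some (f ab).1 ∧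
        P.padd (f a).2 (f b).2 = some (f ab).2) ∧
      (∀ a b s t, P.padd (f a).1 (f b).1 = some s → P.le s c →
        P.padd (f a).2 (f b).2 = some t → P.le t cs →
        ∃ ab, P.padd a b = some ab)

/-- The center `Γ(E)`. -/
def center (P : PartialStruct E) : Set E := {c | P.IsCentral c}

/-- The central interval `Γ(E)[0,c] = Γ(E) ∩ E[0,c]`. -/
def centerIntervalSet (P : PartialStruct E) (c : E) : Set E :=
  {x | P.IsCentral x ∧ P.le x c}

/-- A Γ-orthogonal family: one dominated elementwise by a pairwise
disjoint family of central elements. -/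
def GammaOrthogonal (P : PartialStruct E) {I : Type} (e : I → E) : Prop :=
  ∃ c : I → E, (∀ i, P.IsCentral (c i)) ∧
    (∀ i j, i ≠ j → P.IsMeet (c i) (c j) P.zero) ∧
    ∀ i, P.le (e i) (c i)

/-- Centrally orthocomplete: every Γ-orthogonal family has a supremum. -/
def IsCOPEA (P : PartialStruct E) : Prop :=
  ∀ (I : Type) (e : I → E), P.GammaOrthogonal e → ∃ s, P.IsSup (Set.range e) s

/-- `c` is the central cover of `e`: the smallest central element above `e`. -/
def IsCentralCover (P : PartialStruct E) (c e : E) : Prop :=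
  P.IsCentral c ∧ P.le e c ∧ ∀ d, P.IsCentral d → P.le e d → P.le c d

/-- `[Q]`: the set of all suprema of Γ-orthogonal families of elements of `Q`. -/
def bra (P : PartialStruct E) (Q : Set E) : Set E :=
  {s | ∃ (I : Type) (e : I → E), (∀ i, e i ∈ Q) ∧ P.GammaOrthogonal e ∧
    P.IsSup (Set.range e) s}

/-- `Q^γ = {q ∧ c : q ∈ Q, c ∈ Γ(E)}`. -/
def gammaClosure (P : PartialStruct E) (Q : Set E) : Set E :=
  {m | ∃ q ∈ Q, ∃ c, P.IsCentral c ∧ P.IsMeet q c m}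

/-- `Q↓ = ⋃_{q ∈ Q} E[0,q]`. -/
def downSet (P : PartialStruct E) (Q : Set E) : Set E :=
  {e | ∃ q ∈ Q, P.le e q}

/-- `Q' = {e ∈ E : q ∧ e = 0 for all q ∈ Q}`. -/
def commutant (P : PartialStruct E) (Q : Set E) : Set E :=
  {e | ∀ q ∈ Q, P.IsMeet q e P.zero}

/-- A type-determining (TD) set: `K = [K] = K^γ`. -/
def IsTD (P : PartialStruct E) (K : Set E) : Prop :=
  P.bra K = K ∧ P.gammaClosure K = K

/-- A strongly type-determining (STD) set: `K = [K] = K↓`. -/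
def IsSTD (P : PartialStruct E) (K : Set E) : Prop :=
  P.bra K = K ∧ P.downSet K = K

/-- `c` is the type-cover of `K` (w.r.t. the central cover map `γ`):
the unique central element with `γK = Γ(E)[0,c]`. -/
def IsTypeCover (P : PartialStruct E) (γ : E → E) (K : Set E) (c : E) : Prop :=
  P.IsCentral c ∧ γ '' K = P.centerIntervalSet c

/-- An atom: a nonzero element with no proper nonzero subelement. -/
def IsAtom' (P : PartialStruct E) (a : E) : Prop :=
  a ≠ P.zero ∧ ∀ x, P.le x a → x = P.zero ∨ x = a

end PartialStruct

/-- A PEA-isomorphism between two partial-addition structures: a bijective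
morphism whose inverse is a morphism. -/
structure IsPEAIso {A B : Type} (P : PartialStruct A) (Q : PartialStruct B)
    (f : A → B) : Prop where
  bijective : Function.Bijective f
  map_one : f P.one = Q.one
  map_add : ∀ a b ab, P.padd a b = some ab → Q.padd (f a) (f b) = some (f ab)
  rev_add : ∀ a b s, Q.padd (f a) (f b) = some s → ∃ ab, P.padd a b = some ab

open scoped Classical in
/-- The (coordinatewise) product of a family of partial structures. -/
noncomputable def prodStruct {I : Type} {A : I → Type}
    (Ps : ∀ i, PartialStruct (A i)) : PartialStruct (∀ i, A i) where
  padd a b :=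
    if h : ∀ i, ∃ s, (Ps i).padd (a i) (b i) = some s
    then some fun i => Classical.choose (h i)
    else none
  zero := fun i => (Ps i).zero
  one := fun i => (Ps i).one

/-- A pseudo-effect algebra. -/
structure PEA (E : Type) extends PartialStruct E where
  assoc_def : ∀ a b c : E,
    (∃ ab, padd a b = some ab ∧ ∃ x, padd ab c = some x) ↔
    (∃ bc, padd b c = some bc ∧ ∃ y, padd a bc = some y)
  assoc_eq : ∀ a b c ab bc x y, padd a b = some ab → padd ab c = some x →
    padd b c = some bc → padd a bc = some y → x = y
  exu_right : ∀ a : E, ∃! d, padd a d = some one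
  exu_left : ∀ a : E, ∃! e, padd e a = some one
  shift : ∀ a b ab, padd a b = some ab →
    (∃ d, padd d a = some ab) ∧ (∃ e, padd b e = some ab)
  one_add : ∀ a x, padd one a = some x → a = zero
  add_one : ∀ a x, padd a one = some x → a = zero

namespace PEA

variable {E : Type} (P : PEA E)

/-- Shorthand for the underlying partial structure. -/
abbrev ps : PartialStruct E := P.toPartialStruct

theorem one_add_zero : P.padd P.one P.zero = some P.one := by
  obtain ⟨d, hd, -⟩ := P.exu_right P.one
  have h := P.one_add d P.one hd
  rwa [h] at hd

theorem zero_add_one : P.padd P.zero P.one = some P.one := by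
  obtain ⟨e, he, -⟩ := P.exu_left P.one
  have h := P.add_one e P.one he
  rwa [h] at he

theorem padd_zero (a : E) : P.padd a P.zero = some a := by
  obtain ⟨e, he, -⟩ := P.exu_left a
  have h1 : ∃ ab, P.padd e a = some ab ∧ ∃ x, P.padd ab P.zero = some x :=
    ⟨P.one, he, P.one, P.one_add_zero⟩
  obtain ⟨t, ht, y, hy⟩ := (P.assoc_def e a P.zero).mp h1
  have hxy : P.one = y :=
    P.assoc_eq e a P.zero P.one t P.one y he P.one_add_zero ht hy
  obtain ⟨d, hd, hu⟩ := P.exu_right e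
  have hta : t = a := by
    have h2 : t = d := hu t (by rw [← hxy] at hy; exact hy)
    have h3 : a = d := hu a he
    rw [h2, h3]
  rwa [hta] at ht

theorem zero_padd (a : E) : P.padd P.zero a = some a := by
  obtain ⟨d, hd, -⟩ := P.exu_right a
  have h1 : ∃ bc, P.padd a d = some bc ∧ ∃ y, P.padd P.zero bc = some y :=
    ⟨P.one, hd, P.one, P.zero_add_one⟩
  obtain ⟨t, ht, y, hy⟩ := (P.assoc_def P.zero a d).mpr h1
  have hxy : y = P.one :=
    P.assoc_eq P.zero a d t P.one y P.one ht hy hd P.zero_add_one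
  obtain ⟨e, he, hu⟩ := P.exu_left d
  have hta : t = a := by
    have h2 : t = e := hu t (by rw [hxy] at hy; exact hy)
    have h3 : a = e := hu a hd
    rw [h2, h3]
  rwa [hta] at ht

theorem zero_le (a : E) : P.ps.le P.zero a := ⟨a, P.zero_padd a⟩

theorem le_refl (a : E) : P.ps.le a a := ⟨P.zero, P.padd_zero a⟩

open scoped Classical in
/-- The interval pseudo-effect algebra `E[0,p]` as a partial structure on
the subtype `{x // x ≤ p}`; the sum is defined iff it is defined in `E`
and lies below `p`, and the unit is `p`. -/
noncomputable def intervalStruct (p : E) :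
    PartialStruct {x : E // P.ps.le x p} where
  padd a b := (P.padd a.1 b.1).bind fun s =>
    if h : P.ps.le s p then some ⟨s, h⟩ else none
  zero := ⟨P.zero, P.zero_le p⟩
  one := ⟨p, P.le_refl p⟩

end PEA

/-- The order relation of a complete Boolean algebra structure, made explicit. -/
def cbaLe {X : Type} (inst : CompleteBooleanAlgebra X) (a b : X) : Prop :=
  @LE.le X (by letI := inst; exact inferInstance) a b

end PEApaper

namespace PEApaper

namespace PEA

variable {E : Type} (P : PEA E)

theorem padd_assoc {a b c ab x : E} (h₁ : P.padd a b = some ab) (h₂ : P.padd ab c = some x) :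
    ∃ bc, P.padd b c = some bc ∧ P.padd a bc = some x := by
  obtain ⟨bc, hbc, y, hy⟩ := (P.assoc_def a b c).mp ⟨ab, h₁, x, h₂⟩
  obtain rfl := P.assoc_eq a b c ab bc x y h₁ h₂ hbc hy
  exact ⟨bc, hbc, hy⟩

theorem padd_assoc' {a b c bc x : E} (h₁ : P.padd b c = some bc) (h₂ : P.padd a bc = some x) :
    ∃ ab, P.padd a b = some ab ∧ P.padd ab c = some x := by
  obtain ⟨ab, hab, y, hy⟩ := (P.assoc_def a b c).mpr ⟨bc, h₁, x, h₂⟩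
  obtain rfl := P.assoc_eq a b c ab bc y x hab hy h₁ h₂
  exact ⟨ab, hab, hy⟩

theorem le_trans {a b c : E} (h₁ : P.ps.le a b) (h₂ : P.ps.le b c) : P.ps.le a c := by
  obtain ⟨x, hx⟩ := h₁
  obtain ⟨y, hy⟩ := h₂
  obtain ⟨z, -, hz⟩ := P.padd_assoc hx hy
  exact ⟨z, hz⟩

theorem eq_zero_of_padd_eq_left {t a : E} (h : P.padd a t = some a) : t = P.zero := by
  obtain ⟨z, hz, -⟩ := P.exu_left a
  obtain ⟨w, hw, hw'⟩ := P.padd_assoc' h hz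
  obtain rfl : w = P.one := by simpa [hz] using hw.symm
  exact P.one_add t _ hw'

theorem eq_zero_of_le_zero {a : E} (h : P.ps.le a P.zero) : a = P.zero := by
  obtain ⟨x, hx⟩ := h
  obtain ⟨w, hw, -⟩ := P.padd_assoc hx P.zero_add_one
  obtain rfl := P.add_one x _ hw
  simpa [P.padd_zero] using hx

theorem le_antisymm {a b : E} (h₁ : P.ps.le a b) (h₂ : P.ps.le b a) : a = b := by
  obtain ⟨x, hx⟩ := h₁
  obtain ⟨y, hy⟩ := h₂
  obtain ⟨z, hxy, hz⟩ := P.padd_assoc hx hy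
  obtain rfl := P.eq_zero_of_padd_eq_left hz
  obtain rfl := P.eq_zero_of_le_zero ⟨y, hxy⟩
  simpa [P.padd_zero] using hx

variable {P}

theorem isCentral_properties {c c' : E} (hc : P.ps.IsCentral c)
    (hc' : P.padd c c' = some P.one) :
    P.padd c' c = some P.one ∧ P.ps.IsCentral c' ∧ P.ps.IsMeet c c' P.zero ∧
      ∀ k, P.ps.IsMeet k c P.zero → P.ps.le k c' := by
  obtain ⟨cs, hcs, f, hle, hinj, hsurj, hfc, hf1, hsum, hadd, hrev⟩ := hc
  obtain rfl : cs = c' := (P.exu_right c).unique hcs hc'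
  have left : ∀ x, P.ps.le x c → f x = (x, P.zero) := by
    intro x hx
    obtain ⟨z, hz⟩ := hsurj (x, P.zero) hx (P.zero_le _)
    have h := hsum z
    rw [hz] at h
    obtain rfl : x = z := by simpa [P.padd_zero] using h
    exact hz
  have right : ∀ x, P.ps.le x cs → f x = (P.zero, x) := by
    intro x hx
    obtain ⟨z, hz⟩ := hsurj (P.zero, x) (P.zero_le _) hx
    have h := hsum z
    rw [hz] at h
    obtain rfl : x = z := by simpa [P.zero_padd] using h
    exact hz
  have hsum' : ∀ x, P.padd (f x).2 (f x).1 = some x := by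
    intro x
    have h₁ := left _ (hle x).1
    have h₂ := right _ (hle x).2
    obtain ⟨y, hy⟩ := hrev (f x).2 (f x).1 (f x).1 (f x).2
      (by rw [h₁, h₂]; exact P.zero_padd _) (hle x).1
      (by rw [h₁, h₂]; exact P.padd_zero _) (hle x).2
    have h := hadd _ _ _ hy
    rw [h₁, h₂] at h
    simp only [P.zero_padd, P.padd_zero, Option.some.injEq] at h
    rw [hy, hinj (Prod.ext h.1.symm h.2.symm)]
  have hcomm : P.padd cs c = some P.one := by simpa [hf1] using hsum' P.one
  refine ⟨hcomm, ⟨c, hcomm, fun x => ((f x).2, (f x).1), fun x => (hle x).symm, ?_, ?_, ?_, ?_,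
    hsum', fun a b ab h => (hadd a b ab h).symm, ?_⟩, ⟨P.zero_le _, P.zero_le _, ?_⟩, ?_⟩
  · intro x y h
    simp only [Prod.mk.injEq] at h
    exact hinj (Prod.ext h.2 h.1)
  · intro y h₁ h₂
    obtain ⟨x, hx⟩ := hsurj (y.2, y.1) h₂ h₁
    exact ⟨x, by simp [hx]⟩
  · simp [right cs (P.le_refl _)]
  · simp [hf1]
  · intro a b s t h₁ h₂ h₃ h₄
    exact hrev a b t s h₃ h₄ h₁ h₂
  · intro x h₁ h₂
    have h := (left x h₁).symm.trans (right x h₂)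
    rw [(Prod.mk.inj h).1]
    exact P.le_refl _
  · intro k hk
    have h := hsum k
    rw [P.eq_zero_of_le_zero (hk.2.2 _ ⟨_, hsum k⟩ (hle k).1), P.zero_padd] at h
    rw [← Option.some.inj h]
    exact (hle k).2

end PEA

end PEApaper

open PEApaper PEApaper.PartialStruct in
/-- Lemma 5.8: in a COPEA, for a TD set `K`, the restricted type-cover of
`K'` equals the Boolean complement of the type-cover of `K`:
`c_{K' ∩ γ(K')} = (c_K)'`. -/
theorem stmt15 {E : Type} (P : PEA E) (hco : P.ps.IsCOPEA)
    (γ : E → E) (hγ : ∀ e, P.ps.IsCentralCover (γ e) e)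
    (K : Set E) (hK : P.ps.IsTD K)
    (cK : E) (hcK : P.ps.IsTypeCover γ K cK)
    (cK' : E) (hcK' : P.ps.padd cK cK' = some P.ps.one)
    (d : E) (hd : P.ps.IsCentral d ∧
      P.ps.commutant K ∩ (γ '' P.ps.commutant K) = P.ps.centerIntervalSet d) :
    d = cK' := by
  obtain ⟨hcen, hcov⟩ := hcK
  obtain ⟨hdc, hd⟩ := hd
  obtain ⟨-, hcen', hdisj, -⟩ := PEA.isCentral_properties hcen hcK'
  apply P.le_antisymm
  · obtain ⟨ds, hds, -⟩ := P.exu_right d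
    obtain ⟨hds', hdscen, -, hle⟩ := PEA.isCentral_properties hdc hds
    obtain ⟨k, hk, rfl⟩ : cK ∈ γ '' K := hcov ▸ ⟨hcen, P.le_refl _⟩
    have hmem : d ∈ P.ps.commutant K ∩ (γ '' P.ps.commutant K) := hd ▸ ⟨hdc, P.le_refl _⟩
    obtain ⟨y, hy⟩ := (hγ k).2.2 ds hdscen (hle k (hmem.1 k hk))
    obtain ⟨z, hz, hz'⟩ := P.padd_assoc hy hds'
    obtain rfl := (P.exu_right _).unique hz' hcK'
    exact (P.shift _ _ _ hz).2
  · have hcomm : cK' ∈ P.ps.commutant K := by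
      intro q hq
      have hγq : γ q ∈ P.ps.centerIntervalSet cK := hcov ▸ ⟨q, hq, rfl⟩
      exact ⟨P.zero_le _, P.zero_le _, fun x h₁ h₂ =>
        hdisj.2.2 x (P.le_trans h₁ (P.le_trans (hγ q).2.1 hγq.2)) h₂⟩
    have hfix : γ cK' = cK' :=
      P.le_antisymm ((hγ _).2.2 _ hcen' (P.le_refl _)) (hγ _).2.1
    have hmem : cK' ∈ P.ps.centerIntervalSet d := hd ▸ ⟨hcomm, cK', hcomm, hfix⟩
    exact hmem.2
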